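/- For every dimension d ≥ 1 and every C₀ ≥ 1 there is a constant C, depending only on d and C₀, such that for every Radon measure μ on ℝ^d and every ball B ⊂ ℝ^d with μ((1/2)B) > 0 and μ(2B) ≤ C₀·μ((1/2)B), one has β_{1,μ}(B) ≤ bβ_{1,μ}(B) ≤ C·α_μ(2B). -/

import Mathlib

open MeasureTheory Metric
open scoped ENNReal NNReal

/-- `L` is an affine line in `ℝ^d`. -/
def IsLine {d : ℕ} (L : Set (EuclideanSpace ℝ (Fin d))) : Prop :=
  ∃ x v : EuclideanSpace ℝ (Fin d), v ≠ 0 ∧ L = {y | ∃ t : ℝ, y = x + t • v}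

/-- The support of a measure on a metric space. -/
def msupport {X : Type*} [MeasurableSpace X] [PseudoMetricSpace X] (μ : Measure X) : Set X :=
  {x | ∀ r : ℝ, 0 < r → 0 < μ (ball x r)}

/-- `dist_B(σ,ν)`: supremum of `|∫ f dσ − ∫ f dν|` over 1-Lipschitz `f` supported in `B`. -/
noncomputable def distB {d : ℕ} (B : Set (EuclideanSpace ℝ (Fin d)))
    (σ ν : Measure (EuclideanSpace ℝ (Fin d))) : ℝ :=
  ⨆ f : {f : EuclideanSpace ℝ (Fin d) → ℝ // LipschitzWith 1 f ∧ Function.support f ⊆ B},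
    |(∫ x, f.1 x ∂σ) - ∫ x, f.1 x ∂ν|

/-- The coefficient `α_μ(B)` for the ball `B` of radius `r`. -/
noncomputable def alphaMu {d : ℕ} (μ : Measure (EuclideanSpace ℝ (Fin d)))
    (B : Set (EuclideanSpace ℝ (Fin d))) (r : ℝ) : ℝ :=
  (1 / (r * (μ B).toReal)) *
    ⨅ p : {p : ℝ × Set (EuclideanSpace ℝ (Fin d)) // 0 ≤ p.1 ∧ IsLine p.2},
      distB B μ ((ENNReal.ofReal p.1.1) • (μH[1].restrict p.1.2))

/-- `β_{1,μ}(B)` for the ball `B = B(x,r)`. -/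
noncomputable def beta1 {d : ℕ} (μ : Measure (EuclideanSpace ℝ (Fin d)))
    (x : EuclideanSpace ℝ (Fin d)) (r : ℝ) : ℝ :=
  ⨅ L : {L : Set (EuclideanSpace ℝ (Fin d)) // IsLine L},
    (1 / (μ (ball x r)).toReal) * ∫ y in ball x r, infDist y L.1 / r ∂μ

/-- The bilateral coefficient `bβ_{1,μ}(B)` for the ball `B = B(x,r)`. -/
noncomputable def bbeta1 {d : ℕ} (μ : Measure (EuclideanSpace ℝ (Fin d)))
    (x : EuclideanSpace ℝ (Fin d)) (r : ℝ) : ℝ :=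
  ⨅ L : {L : Set (EuclideanSpace ℝ (Fin d)) // IsLine L},
    ((1 / (μ (ball x r)).toReal) * ∫ y in ball x r, infDist y L.1 / r ∂μ +
      (1 / r) * ∫ y in L.1 ∩ ball x r, infDist y (msupport μ) / r ∂μH[1])

/-! ### Auxiliary facts -/

/-- The cone-shaped bump supported in `B(x,2r)`. -/
noncomputable def bumpF {d : ℕ} (x : EuclideanSpace ℝ (Fin d)) (r : ℝ)
    (y : EuclideanSpace ℝ (Fin d)) : ℝ := max 0 (2 * r - dist y x)

/-- The distance to `A`, truncated by the bump. -/
noncomputable def tstF {d : ℕ} (A : Set (EuclideanSpace ℝ (Fin d)))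
    (x : EuclideanSpace ℝ (Fin d)) (r : ℝ)
    (y : EuclideanSpace ℝ (Fin d)) : ℝ := min (infDist y A) (bumpF x r y)

lemma bumpF_lip {d : ℕ} (x : EuclideanSpace ℝ (Fin d)) (r : ℝ) :
    LipschitzWith 1 (bumpF x r) := by
  refine LipschitzWith.of_le_add fun y z => ?_
  unfold bumpF
  have := dist_triangle z y x
  rw [dist_comm z y] at this
  refine max_le ?_ ?_
  · have := le_max_left 0 (2 * r - dist z x)
    have := dist_nonneg (x := y) (y := z)
    linarith
  · have := le_max_right 0 (2 * r - dist z x)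
    linarith

lemma bumpF_nonneg {d : ℕ} (x : EuclideanSpace ℝ (Fin d)) (r : ℝ) (y) : 0 ≤ bumpF x r y :=
  le_max_left _ _

lemma bumpF_le {d : ℕ} (x : EuclideanSpace ℝ (Fin d)) {r : ℝ} (hr : 0 < r) (y) :
    bumpF x r y ≤ 2 * r := by
  have := dist_nonneg (x := y) (y := x)
  exact max_le (by linarith) (by linarith)

lemma bumpF_zero {d : ℕ} (x : EuclideanSpace ℝ (Fin d)) (r : ℝ) (y)
    (hy : y ∉ ball x (2 * r)) : bumpF x r y = 0 := by
  rw [mem_ball, not_lt] at hy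
  exact max_eq_left (by linarith)

lemma tstF_lip {d : ℕ} (A : Set (EuclideanSpace ℝ (Fin d))) (x : EuclideanSpace ℝ (Fin d)) (r : ℝ) :
    LipschitzWith 1 (tstF A x r) := by
  have := (lipschitz_infDist_pt A).min (bumpF_lip x r)
  rw [max_self] at this
  exact this

lemma tstF_nonneg {d : ℕ} (A : Set (EuclideanSpace ℝ (Fin d))) (x : EuclideanSpace ℝ (Fin d))
    (r : ℝ) (y) : 0 ≤ tstF A x r y :=
  le_min infDist_nonneg (bumpF_nonneg x r y)

lemma tstF_zero {d : ℕ} (A : Set (EuclideanSpace ℝ (Fin d))) (x : EuclideanSpace ℝ (Fin d)) (r : ℝ)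
    (y) (hy : y ∉ ball x (2 * r)) : tstF A x r y = 0 := by
  unfold tstF
  rw [bumpF_zero x r y hy]
  exact min_eq_right infDist_nonneg

lemma tstF_zero' {d : ℕ} (A : Set (EuclideanSpace ℝ (Fin d))) (x : EuclideanSpace ℝ (Fin d)) (r : ℝ)
    (y) (hy : y ∈ A) : tstF A x r y = 0 := by
  unfold tstF
  rw [infDist_zero_of_mem hy]
  exact min_eq_left (bumpF_nonneg x r y)

lemma integrable_aux {d : ℕ} {σ : Measure (EuclideanSpace ℝ (Fin d))}
    {x : EuclideanSpace ℝ (Fin d)} {R : ℝ} (hσ : σ (ball x R) < ∞)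
    {f : EuclideanSpace ℝ (Fin d) → ℝ} (hf : Continuous f) (K : ℝ)
    (hK : ∀ y, |f y| ≤ K) (h0 : ∀ y, y ∉ ball x R → f y = 0) : Integrable f σ := by
  rw [← integrableOn_iff_integrable_of_support_subset (s := ball x R)]
  · exact Measure.integrableOn_of_bounded hσ.ne hf.aestronglyMeasurable
      (Filter.Eventually.of_forall hK)
  · intro y hy
    by_contra h
    exact hy (h0 y h)

lemma bumpF_integrable {d : ℕ} {σ : Measure (EuclideanSpace ℝ (Fin d))}
    {x : EuclideanSpace ℝ (Fin d)} {r : ℝ} (hr : 0 < r) (hσ : σ (ball x (2 * r)) < ∞) :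
    Integrable (bumpF x r) σ := by
  refine integrable_aux hσ (bumpF_lip x r).continuous (2 * r) (fun y => ?_) (bumpF_zero x r)
  rw [abs_of_nonneg (bumpF_nonneg x r y)]
  exact bumpF_le x hr y

lemma tstF_integrable {d : ℕ} {σ : Measure (EuclideanSpace ℝ (Fin d))}
    (A : Set (EuclideanSpace ℝ (Fin d)))
    {x : EuclideanSpace ℝ (Fin d)} {r : ℝ} (hr : 0 < r) (hσ : σ (ball x (2 * r)) < ∞) :
    Integrable (tstF A x r) σ := by
  refine integrable_aux hσ (tstF_lip A x r).continuous (2 * r) (fun y => ?_) (tstF_zero A x r)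
  rw [abs_of_nonneg (tstF_nonneg A x r y)]
  exact (min_le_right _ _).trans (bumpF_le x hr y)

lemma setInt_le_tstF {d : ℕ} {σ : Measure (EuclideanSpace ℝ (Fin d))}
    (A : Set (EuclideanSpace ℝ (Fin d)))
    {x : EuclideanSpace ℝ (Fin d)} {r : ℝ} (hr : 0 < r) (hσ : σ (ball x (2 * r)) < ∞)
    (hA : (A ∩ ball x (2 * r)).Nonempty) :
    ∫ y in ball x r, infDist y A ∂σ ≤ 3 * ∫ y, tstF A x r y ∂σ := by
  have hI := tstF_integrable A hr hσ
  have hsub : ball x r ⊆ ball x (2 * r) := ball_subset_ball (by linarith)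
  obtain ⟨z, hzA, hz⟩ := hA
  rw [mem_ball] at hz
  have hd : ∀ y ∈ ball x r, infDist y A ≤ 3 * r := by
    intro y hy
    rw [mem_ball] at hy
    have h1 := infDist_le_dist_of_mem (x := y) hzA
    have h2 := dist_triangle_right y z x
    linarith
  have hfin : σ (ball x r) ≠ ∞ := ((measure_mono hsub).trans_lt hσ).ne
  have h1 : ∫ y in ball x r, infDist y A ∂σ ≤ ∫ y in ball x r, 3 * tstF A x r y ∂σ := by
    refine setIntegral_mono_on ?_ (hI.const_mul 3).integrableOn measurableSet_ball ?_
    · refine Measure.integrableOn_of_bounded hfin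
        (continuous_infDist_pt A).aestronglyMeasurable (M := 3 * r) ?_
      filter_upwards [ae_restrict_mem measurableSet_ball] with y hy
      rw [Real.norm_eq_abs, abs_of_nonneg infDist_nonneg]
      exact hd y hy
    · intro y hy
      have h3 := hd y hy
      rw [mem_ball] at hy
      have h4 : r ≤ bumpF x r y := le_trans (by linarith) (le_max_right _ _)
      have h5 : infDist y A / 3 ≤ tstF A x r y :=
        le_min (by have := infDist_nonneg (x := y) (s := A); linarith) (by linarith)
      linarith
  refine h1.trans ?_
  rw [← integral_const_mul]
  refine setIntegral_le_integral (hI.const_mul 3) (Filter.Eventually.of_forall fun y => ?_)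
  have := tstF_nonneg A x r y
  simp only [Pi.zero_apply]
  linarith

lemma exists_unit {d : ℕ} (hd : 1 ≤ d) : ∃ e : EuclideanSpace ℝ (Fin d), ‖e‖ = 1 :=
  ⟨EuclideanSpace.single ⟨0, hd⟩ 1, by simp⟩

lemma le_distB {d : ℕ} (hd : 1 ≤ d) {σ ν : Measure (EuclideanSpace ℝ (Fin d))}
    {x : EuclideanSpace ℝ (Fin d)} {R : ℝ} (hR : 0 < R)
    (hσ : σ (ball x R) < ∞) (hν : ν (ball x R) < ∞)
    {f : EuclideanSpace ℝ (Fin d) → ℝ} (hf : LipschitzWith 1 f)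
    (h0 : ∀ y, y ∉ ball x R → f y = 0) :
    |(∫ y, f y ∂σ) - ∫ y, f y ∂ν| ≤ distB (ball x R) σ ν := by
  have hbd : ∀ (τ : Measure (EuclideanSpace ℝ (Fin d))), τ (ball x R) < ∞ →
      ∀ g : EuclideanSpace ℝ (Fin d) → ℝ, LipschitzWith 1 g → Function.support g ⊆ ball x R →
      |∫ y, g y ∂τ| ≤ 2 * R * τ.real (ball x R) := by
    intro τ hτ g hg hs
    have hz : ∀ y, y ∉ ball x R → g y = 0 := by
      intro y hy
      by_contra h
      exact hy (hs h)
    rw [← setIntegral_eq_integral_of_forall_compl_eq_zero hz, ← Real.norm_eq_abs]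
    refine norm_setIntegral_le_of_norm_le_const hτ fun y hy => ?_
    obtain ⟨e, he⟩ := exists_unit hd
    have hdx : dist (x + R • e) x = R := by
      rw [dist_eq_norm, add_sub_cancel_left, norm_smul, he, Real.norm_eq_abs, abs_of_pos hR,
        mul_one]
    have h1 := hg.dist_le_mul y (x + R • e)
    rw [hz (x + R • e) (by rw [mem_ball, hdx]; exact lt_irrefl R), dist_zero_right] at h1
    have h2 := dist_triangle_right y (x + R • e) x
    rw [mem_ball] at hy
    simp only [NNReal.coe_one, one_mul] at h1
    linarith
  unfold distB
  refine le_ciSup (f := fun f : {f : EuclideanSpace ℝ (Fin d) → ℝ //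
      LipschitzWith 1 f ∧ Function.support f ⊆ ball x R} =>
      |(∫ x, f.1 x ∂σ) - ∫ x, f.1 x ∂ν|) ?_ ⟨f, hf, ?_⟩
  · refine ⟨2 * R * σ.real (ball x R) + 2 * R * ν.real (ball x R), ?_⟩
    rintro _ ⟨g, rfl⟩
    exact (abs_sub _ _).trans
      (add_le_add (hbd σ hσ g.1 g.2.1 g.2.2) (hbd ν hν g.1 g.2.1 g.2.2))
  · intro y hy
    by_contra h
    exact hy (h0 y h)

lemma line_measure {d : ℕ} {L : Set (EuclideanSpace ℝ (Fin d))} (hL : IsLine L)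
    (x : EuclideanSpace ℝ (Fin d)) {R : ℝ} :
    (μH[1] : Measure (EuclideanSpace ℝ (Fin d))) (L ∩ ball x R) ≤ ENNReal.ofReal (2 * R) := by
  obtain ⟨p, v, hv, rfl⟩ := hL
  have hn : ‖v‖ ≠ 0 := norm_ne_zero_iff.2 hv
  let g : ℝ → EuclideanSpace ℝ (Fin d) := fun t => p + t • (‖v‖⁻¹ • v)
  have hg : Isometry g := by
    refine Isometry.of_dist_eq fun s t => ?_
    simp only [g, dist_add_left]
    rw [dist_eq_norm, ← sub_smul, norm_smul, norm_smul, norm_inv, norm_norm,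
      inv_mul_cancel₀ hn, mul_one, Real.dist_eq, Real.norm_eq_abs]
  have hsub : {y | ∃ t : ℝ, y = p + t • v} ∩ ball x R ⊆ g '' (g ⁻¹' ball x R) := by
    rintro y ⟨⟨t, rfl⟩, hy⟩
    have : g (t * ‖v‖) = p + t • v := by
      simp only [g]
      rw [smul_smul, mul_assoc, mul_inv_cancel₀ hn, mul_one]
    exact ⟨t * ‖v‖, by rw [Set.mem_preimage, this]; exact hy, this⟩
  refine (measure_mono hsub).trans ?_
  rw [hg.hausdorffMeasure_image (Or.inl zero_le_one), hausdorffMeasure_real]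
  refine (Real.volume_le_diam _).trans (ediam_le_of_forall_dist_le fun s hs t ht => ?_)
  rw [Set.mem_preimage, mem_ball] at hs ht
  rw [← hg.dist_eq]
  have := dist_triangle_right (g s) (g t) x
  linarith

lemma msupport_ae {d : ℕ} (μ : Measure (EuclideanSpace ℝ (Fin d))) :
    ∀ᵐ y ∂μ, y ∈ msupport μ := by
  have h : msupport μ = μ.support := by
    ext y
    rw [nhds_basis_ball.mem_measureSupport]
    rfl
  rw [h]
  exact Measure.support_mem_ae

lemma bbeta1_nonneg_terms {d : ℕ} (μ : Measure (EuclideanSpace ℝ (Fin d)))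
    (x : EuclideanSpace ℝ (Fin d)) {r : ℝ} (hr : 0 < r) (L : Set (EuclideanSpace ℝ (Fin d))) :
    0 ≤ (1 / (μ (ball x r)).toReal) * ∫ y in ball x r, infDist y L / r ∂μ ∧
    0 ≤ (1 / r) * ∫ y in L ∩ ball x r, infDist y (msupport μ) / r ∂μH[1] := by
  constructor
  · exact mul_nonneg (by positivity) (integral_nonneg fun y => div_nonneg infDist_nonneg hr.le)
  · exact mul_nonneg (by positivity) (integral_nonneg fun y => div_nonneg infDist_nonneg hr.le)

lemma bbeta1_le {d : ℕ} (μ : Measure (EuclideanSpace ℝ (Fin d)))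
    (x : EuclideanSpace ℝ (Fin d)) {r : ℝ} (hr : 0 < r) {L : Set (EuclideanSpace ℝ (Fin d))}
    (hL : IsLine L) :
    bbeta1 μ x r ≤ (1 / (μ (ball x r)).toReal) * ∫ y in ball x r, infDist y L / r ∂μ +
      (1 / r) * ∫ y in L ∩ ball x r, infDist y (msupport μ) / r ∂μH[1] := by
  unfold bbeta1
  refine ciInf_le (f := fun L : {L : Set (EuclideanSpace ℝ (Fin d)) // IsLine L} =>
    ((1 / (μ (ball x r)).toReal) * ∫ y in ball x r, infDist y L.1 / r ∂μ +
      (1 / r) * ∫ y in L.1 ∩ ball x r, infDist y (msupport μ) / r ∂μH[1])) ?_ ⟨L, hL⟩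
  refine ⟨0, ?_⟩
  rintro _ ⟨L', rfl⟩
  have := bbeta1_nonneg_terms μ x hr L'.1
  exact add_nonneg this.1 this.2

lemma supp_nonempty {d : ℕ} (μ : Measure (EuclideanSpace ℝ (Fin d)))
    (x : EuclideanSpace ℝ (Fin d)) {R : ℝ} (hpos : 0 < μ (ball x R)) :
    (msupport μ ∩ ball x R).Nonempty := by
  by_contra h
  have hae := msupport_ae μ
  have : μ (ball x R) = 0 := by
    refine measure_mono_null (fun y hy => ?_) (ae_iff.1 hae)
    intro hys
    exact h ⟨y, hys, hy⟩
  exact hpos.ne' this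

/-- The crude bound, valid without any flatness. -/
lemma bbeta1_le_five {d : ℕ} (hd : 1 ≤ d) (μ : Measure (EuclideanSpace ℝ (Fin d)))
    (x : EuclideanSpace ℝ (Fin d)) {r : ℝ} (hr : 0 < r) (hpos : 0 < μ (ball x (r / 2)))
    (hfin : μ (ball x r) < ∞) :
    bbeta1 μ x r ≤ 5 := by
  obtain ⟨e, he⟩ := exists_unit hd
  have hL : IsLine {y : EuclideanSpace ℝ (Fin d) | ∃ t : ℝ, y = x + t • e} :=
    ⟨x, e, by rintro rfl; simp at he, rfl⟩
  set L := {y : EuclideanSpace ℝ (Fin d) | ∃ t : ℝ, y = x + t • e} with hLdef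
  have hxL : x ∈ L := ⟨0, by simp⟩
  refine (bbeta1_le μ x hr hL).trans ?_
  have hB : 0 < (μ (ball x r)).toReal :=
    ENNReal.toReal_pos (hpos.trans_le (measure_mono (ball_subset_ball (by linarith)))).ne' hfin.ne
  have h1 : ∫ y in ball x r, infDist y L / r ∂μ ≤ 1 * μ.real (ball x r) := by
    refine (le_abs_self _).trans ?_
    rw [← Real.norm_eq_abs]
    refine norm_setIntegral_le_of_norm_le_const hfin fun y hy => ?_
    rw [Real.norm_eq_abs, abs_of_nonneg (div_nonneg infDist_nonneg hr.le), div_le_one hr]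
    rw [mem_ball] at hy
    exact (infDist_le_dist_of_mem hxL).trans hy.le
  have hm := line_measure hL x (R := r)
  have h2 : ∫ y in L ∩ ball x r, infDist y (msupport μ) / r ∂μH[1] ≤
      2 * (μH[1] : Measure (EuclideanSpace ℝ (Fin d))).real (L ∩ ball x r) := by
    refine (le_abs_self _).trans ?_
    rw [← Real.norm_eq_abs]
    refine norm_setIntegral_le_of_norm_le_const (hm.trans_lt ENNReal.ofReal_lt_top) fun y hy => ?_
    rw [Real.norm_eq_abs, abs_of_nonneg (div_nonneg infDist_nonneg hr.le), div_le_iff₀ hr]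
    obtain ⟨z, hz, hzb⟩ := supp_nonempty μ x hpos
    have h3 := infDist_le_dist_of_mem (x := y) hz
    have h4 := dist_triangle_right y z x
    have h5 := hy.2
    rw [mem_ball] at h5 hzb
    linarith
  have h3 : (μH[1] : Measure (EuclideanSpace ℝ (Fin d))).real (L ∩ ball x r) ≤ 2 * r :=
    ENNReal.toReal_le_of_le_ofReal (by linarith) hm
  have h4 : (1 / (μ (ball x r)).toReal) * ∫ y in ball x r, infDist y L / r ∂μ ≤ 1 := by
    rw [one_div, inv_mul_le_iff₀ hB, mul_one]
    simpa [Measure.real] using h1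
  have h5 : (1 / r) * ∫ y in L ∩ ball x r, infDist y (msupport μ) / r ∂μH[1] ≤ 4 := by
    rw [one_div, inv_mul_le_iff₀ hr]
    linarith
  linarith

lemma core_bound {d : ℕ} (hd : 1 ≤ d) (C₀ : ℝ) (hC₀ : 1 ≤ C₀)
    (μ : Measure (EuclideanSpace ℝ (Fin d)))
    (x : EuclideanSpace ℝ (Fin d)) (r : ℝ) (hr : 0 < r)
    (hpos : 0 < μ (ball x (r / 2))) (hfin : μ (ball x (2 * r)) < ∞)
    (hdbl : (μ (ball x (2 * r))).toReal ≤ C₀ * (μ (ball x (r / 2))).toReal)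
    (c : ℝ) (hc : 0 ≤ c) (L : Set (EuclideanSpace ℝ (Fin d))) (hL : IsLine L) :
    bbeta1 μ x r ≤ 60 * C₀ * (1 / (2 * r * (μ (ball x (2 * r))).toReal) *
      distB (ball x (2 * r)) μ ((ENNReal.ofReal c) • (μH[1].restrict L))) := by
  set ρ : Measure (EuclideanSpace ℝ (Fin d)) := μH[1].restrict L with hρ
  set D := distB (ball x (2 * r)) μ ((ENNReal.ofReal c) • ρ) with hD
  have hsub1 : ball x (r / 2) ⊆ ball x r := ball_subset_ball (by linarith)
  have hsub2 : ball x r ⊆ ball x (2 * r) := ball_subset_ball (by linarith)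
  have hfin1 : μ (ball x r) < ∞ := (measure_mono hsub2).trans_lt hfin
  have hfin0 : μ (ball x (r / 2)) < ∞ := (measure_mono hsub1).trans_lt hfin1
  set M := (μ (ball x (2 * r))).toReal with hM
  set m := (μ (ball x (r / 2))).toReal with hm
  set m1 := (μ (ball x r)).toReal with hm1
  have hmpos : 0 < m := ENNReal.toReal_pos hpos.ne' hfin0.ne
  have hm_m1 : m ≤ m1 := ENNReal.toReal_mono hfin1.ne (measure_mono hsub1)
  have hm1_M : m1 ≤ M := ENNReal.toReal_mono hfin.ne (measure_mono hsub2)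
  have hMpos : 0 < M := by linarith
  have hρ2 : ρ (ball x (2 * r)) ≤ ENNReal.ofReal (4 * r) := by
    rw [hρ, Measure.restrict_apply measurableSet_ball, Set.inter_comm]
    refine (line_measure hL x).trans_eq ?_
    congr 1
    ring
  have hρfin : ρ (ball x (2 * r)) < ∞ := hρ2.trans_lt ENNReal.ofReal_lt_top
  have hνfin : (ENNReal.ofReal c • ρ) (ball x (2 * r)) < ∞ := by
    rw [Measure.smul_apply, smul_eq_mul]
    exact ENNReal.mul_lt_top ENNReal.ofReal_lt_top hρfin
  have htest : ∀ f : EuclideanSpace ℝ (Fin d) → ℝ, LipschitzWith 1 f →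
      (∀ y, y ∉ ball x (2 * r) → f y = 0) → |(∫ y, f y ∂μ) - c * ∫ y, f y ∂ρ| ≤ D := by
    intro f hf h0
    have := le_distB hd (by linarith : (0:ℝ) < 2 * r) hfin hνfin hf h0
    rwa [integral_smul_measure, ENNReal.toReal_ofReal hc, smul_eq_mul] at this
  -- the goal follows from a bound by `m`
  have hkey : 60 * (D / (2 * r * m)) ≤ 60 * C₀ * (1 / (2 * r * M) * D) := by
    have hD0 : 0 ≤ D := (abs_nonneg _).trans (htest _ (bumpF_lip x r) (bumpF_zero x r))
    have : D / (2 * r * m) ≤ C₀ * (1 / (2 * r * M) * D) := by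
      rw [show C₀ * (1 / (2 * r * M) * D) = (C₀ * D) / (2 * r * M) by ring,
        div_le_div_iff₀ (by positivity) (by positivity)]
      have := mul_le_mul_of_nonneg_left hdbl (show 0 ≤ D * (2 * r) by positivity)
      linarith
    linarith
  refine le_trans ?_ hkey
  by_cases hbig : r * m / 2 ≤ D
  · refine (bbeta1_le_five hd μ x hr hpos hfin1).trans ?_
    rw [← mul_div_assoc, le_div_iff₀ (by positivity)]
    nlinarith
  · push Not at hbig
    -- lower bound for the bump integral
    have hb1 : r * m * (3 / 2) ≤ ∫ y, bumpF x r y ∂μ := by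
      have hI := bumpF_integrable (σ := μ) hr hfin
      have h1 : ∫ y in ball x (r / 2), (3 / 2 * r) ∂μ ≤ ∫ y in ball x (r / 2), bumpF x r y ∂μ := by
        refine setIntegral_mono_on ?_ hI.integrableOn measurableSet_ball ?_
        · exact integrableOn_const hfin0.ne
        · intro y hy
          rw [mem_ball] at hy
          exact le_trans (by linarith) (le_max_right _ _)
      have h2 : ∫ y in ball x (r / 2), bumpF x r y ∂μ ≤ ∫ y, bumpF x r y ∂μ :=
        setIntegral_le_integral hI (Filter.Eventually.of_forall (bumpF_nonneg x r))
      rw [setIntegral_const, smul_eq_mul, Measure.real, ← hm] at h1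
      linarith
    have hb2 : ∫ y, bumpF x r y ∂ρ ≤ 8 * r ^ 2 := by
      rw [← setIntegral_eq_integral_of_forall_compl_eq_zero (bumpF_zero x r)]
      have h1 : ‖∫ y in ball x (2 * r), bumpF x r y ∂ρ‖ ≤ 2 * r * ρ.real (ball x (2 * r)) := by
        refine norm_setIntegral_le_of_norm_le_const hρfin fun y _ => ?_
        rw [Real.norm_eq_abs, abs_of_nonneg (bumpF_nonneg x r y)]
        exact bumpF_le x hr y
      have h2 : ρ.real (ball x (2 * r)) ≤ 4 * r :=
        ENNReal.toReal_le_of_le_ofReal (by linarith) hρ2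
      have h3 := (le_abs_self _).trans h1
      nlinarith
    have hb3 := (abs_le.1 (htest _ (bumpF_lip x r) (bumpF_zero x r))).2
    have hrm : 0 < r * m := by positivity
    have hb4 : r * m ≤ c * ∫ y, bumpF x r y ∂ρ := by linarith
    have hcm : m ≤ 8 * r * c := by
      have := mul_le_mul_of_nonneg_left hb2 hc
      have h5 : r * m ≤ r * (8 * r * c) := by linarith
      exact le_of_mul_le_mul_left h5 hr
    have hcpos : 0 < c := by
      by_contra h
      have : c = 0 := le_antisymm (not_lt.1 h) hc
      rw [this] at hcm
      linarith
    have hmeet : (L ∩ ball x (2 * r)).Nonempty := by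
      by_contra h
      rw [Set.not_nonempty_iff_eq_empty] at h
      have hz : ρ (ball x (2 * r)) = 0 := by
        rw [hρ, Measure.restrict_apply measurableSet_ball, Set.inter_comm, h, measure_empty]
      have : ∫ y, bumpF x r y ∂ρ = 0 := by
        rw [← setIntegral_eq_integral_of_forall_compl_eq_zero (bumpF_zero x r),
          Measure.restrict_eq_zero.2 hz, integral_zero_measure]
      rw [this] at hb4
      linarith
    have hsupp : (msupport μ ∩ ball x (2 * r)).Nonempty :=
      (supp_nonempty μ x hpos).mono (Set.inter_subset_inter_right _ (hsub1.trans hsub2))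
    -- first term
    have hT1 : ∫ y in ball x r, infDist y L ∂μ ≤ 3 * D := by
      have h1 := setInt_le_tstF L hr hfin hmeet
      have h2 := (abs_le.1 (htest _ (tstF_lip L x r) (tstF_zero L x r))).2
      have h3 : ∫ y, tstF L x r y ∂ρ = 0 := by
        exact setIntegral_eq_zero_of_forall_eq_zero fun y hy => tstF_zero' L x r y hy
      rw [h3] at h2
      linarith
    -- second term
    have hT2 : c * ∫ y in L ∩ ball x r, infDist y (msupport μ) ∂μH[1] ≤ 3 * D := by
      have h1 := setInt_le_tstF (msupport μ) hr hρfin hsupp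
      rw [hρ, Measure.restrict_restrict measurableSet_ball, Set.inter_comm, ← hρ] at h1
      have h2 := (abs_le.1 (htest _ (tstF_lip (msupport μ) x r) (tstF_zero (msupport μ) x r))).1
      have h3 : ∫ y, tstF (msupport μ) x r y ∂μ = 0 := by
        refine integral_eq_zero_of_ae ?_
        filter_upwards [msupport_ae μ] with y hy
        exact tstF_zero' _ x r y hy
      rw [h3] at h2
      have := mul_le_mul_of_nonneg_left h1 hc
      linarith
    refine (bbeta1_le μ x hr hL).trans ?_
    rw [integral_div, integral_div]
    set I1 := ∫ y in ball x r, infDist y L ∂μ with hI1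
    set I2 := ∫ y in L ∩ ball x r, infDist y (msupport μ) ∂μH[1] with hI2
    have hI1n : 0 ≤ I1 := integral_nonneg fun y => infDist_nonneg
    have hI2n : 0 ≤ I2 := integral_nonneg fun y => infDist_nonneg
    have e1 : 1 / m1 * (I1 / r) ≤ 3 * D / (r * m) := by
      rw [show 1 / m1 * (I1 / r) = I1 / (r * m1) by ring]
      have : r * m ≤ r * m1 := mul_le_mul_of_nonneg_left hm_m1 hr.le
      exact div_le_div₀ (by linarith) hT1 hrm this
    have e2 : 1 / r * (I2 / r) ≤ 24 * D / (r * m) := by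
      rw [show 1 / r * (I2 / r) = I2 / (r * r) by ring,
        div_le_div_iff₀ (by positivity) (by positivity)]
      have h1 : I2 * m ≤ I2 * (8 * r * c) := mul_le_mul_of_nonneg_left hcm hI2n
      have h2 : r * (I2 * m) ≤ r * (24 * r * D) := by
        refine mul_le_mul_of_nonneg_left ?_ hr.le
        have := mul_le_mul_of_nonneg_left hT2 (show 0 ≤ 8 * r by linarith)
        linarith
      linarith
    have e3 : 60 * (D / (2 * r * m)) = 30 * (D / (r * m)) := by
      field_simp
      ring
    have hD0 : 0 ≤ D := by linarith
    have e4 : 0 ≤ D / (r * m) := by positivity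
    rw [e3]
    rw [mul_div_assoc] at e1 e2
    linarith

theorem stmt12 {d : ℕ} (hd : 1 ≤ d) (C₀ : ℝ) (hC₀ : 1 ≤ C₀) :
    ∃ C : ℝ, 0 < C ∧
      ∀ μ : Measure (EuclideanSpace ℝ (Fin d)), IsLocallyFiniteMeasure μ →
      ∀ (x : EuclideanSpace ℝ (Fin d)) (r : ℝ), 0 < r →
        0 < μ (ball x (r / 2)) →
        μ (ball x (2 * r)) ≤ ENNReal.ofReal C₀ * μ (ball x (r / 2)) →
        beta1 μ x r ≤ bbeta1 μ x r ∧
          bbeta1 μ x r ≤ C * alphaMu μ (ball x (2 * r)) (2 * r) := by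
  refine ⟨60 * C₀, by linarith, fun μ hμ x r hr hpos hdbl => ⟨?_, ?_⟩⟩
  · unfold beta1 bbeta1
    refine ciInf_mono ⟨0, ?_⟩ fun L => ?_
    · rintro _ ⟨L, rfl⟩
      exact (bbeta1_nonneg_terms μ x hr L.1).1
    · exact le_add_of_nonneg_right (bbeta1_nonneg_terms μ x hr L.1).2
  · have hfin : μ (ball x (2 * r)) < ∞ := measure_ball_lt_top
    have hfin0 : μ (ball x (r / 2)) < ∞ := measure_ball_lt_top
    have hdbl' : (μ (ball x (2 * r))).toReal ≤ C₀ * (μ (ball x (r / 2))).toReal := by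
      have := ENNReal.toReal_mono (ENNReal.mul_lt_top ENNReal.ofReal_lt_top hfin0).ne hdbl
      rwa [ENNReal.toReal_mul, ENNReal.toReal_ofReal (by linarith)] at this
    obtain ⟨e, he⟩ := exists_unit hd
    have hL : IsLine {y : EuclideanSpace ℝ (Fin d) | ∃ t : ℝ, y = x + t • e} :=
      ⟨x, e, by rintro rfl; simp at he, rfl⟩
    haveI : Nonempty {p : ℝ × Set (EuclideanSpace ℝ (Fin d)) // 0 ≤ p.1 ∧ IsLine p.2} :=
      ⟨⟨(0, _), le_refl _, hL⟩⟩
    have hMpos : 0 < (μ (ball x (2 * r))).toReal :=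
      ENNReal.toReal_pos
        (hpos.trans_le (measure_mono (ball_subset_ball (by linarith)))).ne' hfin.ne
    unfold alphaMu
    have hk : 0 < 60 * C₀ * (1 / (2 * r * (μ (ball x (2 * r))).toReal)) := by positivity
    rw [← mul_assoc, ← div_le_iff₀' hk]
    refine le_ciInf fun p => ?_
    rw [div_le_iff₀' hk, mul_assoc]
    exact core_bound hd C₀ hC₀ μ x r hr hpos hfin hdbl' p.1.1 p.2.1 p.1.2 p.2.2
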